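/- Fix integers k ≥ 3 and 1 ≤ d < k/2, set k' := k − d, and let g(k,d) := 1 − (1 − (k−d)(k−2d−1)/(k−1)²)·(1 − 1/k)^{k−d}. Then for every ε > 0 there exists n₀ such that for all n ≥ n₀, setting n' := n − d and s + 1 := ⌊(n' − k' + 1)/k⌋, every family F of k'-element subsets of [n'] with |F| > (g(k,d) + ε)·C(n−d, k−d) contains a matching of size s + 1. -/

import Mathlib

def HasM (F : Finset (Finset ℕ)) (t : ℕ) : Prop :=
  ∃ f : Fin t → Finset ℕ, (∀ i, f i ∈ F) ∧ Pairwise (fun i j => Disjoint (f i) (f j))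

def Shifted (V : Finset ℕ) (F : Finset (Finset ℕ)) : Prop :=
  ∀ A ∈ F, ∀ j ∈ A, ∀ i ∈ V, i < j → i ∉ A → insert i (A.erase j) ∈ F

lemma swap_image (i j : ℕ) (A : Finset ℕ) (hj : j ∈ A) (hi : i ∉ A) :
    A.image (Equiv.swap i j) = insert i (A.erase j) := by
  ext x
  simp only [Finset.mem_image, Finset.mem_insert, Finset.mem_erase]
  constructor
  · rintro ⟨a, ha, rfl⟩
    by_cases h1 : a = j
    · subst h1; simp
    · have : a ≠ i := fun h => hi (h ▸ ha)
      rw [Equiv.swap_apply_of_ne_of_ne this h1]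
      exact Or.inr ⟨h1, ha⟩
  · rintro (rfl | ⟨h1, h2⟩)
    · exact ⟨j, hj, by simp⟩
    · have : x ≠ i := fun h => hi (h ▸ h2)
      exact ⟨x, h2, Equiv.swap_apply_of_ne_of_ne this h1⟩

lemma swap_image_id (i j : ℕ) (A : Finset ℕ) (hj : j ∉ A) (hi : i ∉ A) :
    A.image (Equiv.swap i j) = A := by
  have : A.image (Equiv.swap i j) = A.image id := by
    apply Finset.image_congr
    intro x hx
    have hx' : x ∈ A := hx
    simp only [id]
    exact Equiv.swap_apply_of_ne_of_ne (fun h => hi (h ▸ hx')) (fun h => hj (h ▸ hx'))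
  rw [this, Finset.image_id]

lemma swap_swap_image (i j : ℕ) (A : Finset ℕ) :
    (A.image (Equiv.swap i j)).image (Equiv.swap i j) = A := by
  rw [Finset.image_image]
  have : (Equiv.swap i j : ℕ → ℕ) ∘ (Equiv.swap i j) = id := by
    ext x; simp
  rw [this, Finset.image_id]

open Classical in
lemma shift_step (V : Finset ℕ) (K t : ℕ) (F : Finset (Finset ℕ))
    (hF : F ⊆ V.powersetCard K) (hM : ¬ HasM F t) (hS : ¬ Shifted V F) :
    ∃ G ⊆ V.powersetCard K, G.card = F.card ∧ ¬ HasM G t ∧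
      ∑ A ∈ G, ∑ a ∈ A, a < ∑ A ∈ F, ∑ a ∈ A, a := by
  unfold Shifted at hS
  push Not at hS
  obtain ⟨A₀, hA₀, j, hj, i, hiV, hij, hi, hA₀'⟩ := hS
  set σ : Finset ℕ → Finset ℕ := fun A => A.image (Equiv.swap i j) with hσ
  have hσσ : ∀ A, σ (σ A) = A := fun A => swap_swap_image i j A
  have hσe : ∀ A, j ∈ A → i ∉ A → σ A = insert i (A.erase j) := fun A => swap_image i j A
  set S : Finset ℕ → Finset ℕ := fun A => if j ∈ A ∧ i ∉ A ∧ σ A ∉ F then σ A else A with hSdef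
  have hinj : Set.InjOn S F := by
    intro A hA B hB hAB
    have hA' : A ∈ F := hA
    have hB' : B ∈ F := hB
    simp only [hSdef] at hAB
    split_ifs at hAB with h1 h2 h2
    · rw [← hσσ A, hAB, hσσ]
    · exact absurd (hAB ▸ hB') h1.2.2
    · exact absurd (hAB ▸ hA') h2.2.2
    · exact hAB
  have hle : ∀ A, ∑ a ∈ S A, a ≤ ∑ a ∈ A, a := by
    intro A
    simp only [hSdef]
    split_ifs with h
    · rw [hσe A h.1 h.2.1, Finset.sum_insert (by simp [h.2.1])]
      have := Finset.add_sum_erase A (fun x => x) h.1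
      omega
    · exact le_rfl
  refine ⟨F.image S, ?_, Finset.card_image_of_injOn hinj, ?_, ?_⟩
  · intro B hB
    obtain ⟨A, hA, rfl⟩ := Finset.mem_image.1 hB
    have hAP := hF hA
    simp only [hSdef]
    split_ifs with h
    · rw [hσe A h.1 h.2.1]
      rw [Finset.mem_powersetCard] at hAP ⊢
      refine ⟨?_, ?_⟩
      · intro x hx
        rcases Finset.mem_insert.1 hx with rfl | hx
        · exact hiV
        · exact hAP.1 (Finset.mem_of_mem_erase hx)
      · rw [Finset.card_insert_of_notMem (by simp [h.2.1]), Finset.card_erase_of_mem h.1, hAP.2]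
        have : 0 < A.card := Finset.card_pos.2 ⟨j, h.1⟩
        omega
    · exact hAP
  · rintro ⟨f, hf, hd⟩
    by_cases hall : ∀ x, f x ∈ F
    · exact hM ⟨f, hall, hd⟩
    push Not at hall
    obtain ⟨x₀, hx₀⟩ := hall
    apply hM
    refine ⟨fun x => σ (f x), ?_, ?_⟩
    · obtain ⟨A, hA, hAx⟩ := Finset.mem_image.1 (hf x₀)
      have hmoved : j ∈ A ∧ i ∉ A ∧ σ A ∉ F := by
        by_contra hcon
        simp only [hSdef, if_neg hcon] at hAx
        exact hx₀ (hAx ▸ hA)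
      simp only [hSdef, if_pos hmoved] at hAx
      have hix : i ∈ f x₀ := by rw [← hAx, hσe A hmoved.1 hmoved.2.1]; simp
      intro x
      by_cases hxx : x = x₀
      · subst hxx
        show σ (f x) ∈ F
        rw [← hAx, hσσ]; exact hA
      · have hix' : i ∉ f x := fun h => Finset.disjoint_left.1 (hd hxx) h hix
        obtain ⟨B, hB, hBx⟩ := Finset.mem_image.1 (hf x)
        have hnm : ¬ (j ∈ B ∧ i ∉ B ∧ σ B ∉ F) := by
          intro h
          simp only [hSdef, if_pos h] at hBx
          apply hix'
          rw [← hBx, hσe B h.1 h.2.1]; simp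
        simp only [hSdef, if_neg hnm] at hBx
        show σ (f x) ∈ F
        rw [← hBx] at hix' ⊢
        by_cases hjB : j ∈ B
        · by_contra h
          exact hnm ⟨hjB, hix', h⟩
        · have : σ B = B := swap_image_id i j B hjB hix'
          rw [this]; exact hB
    · intro x y hxy
      exact (Finset.disjoint_image (Equiv.injective _)).2 (hd hxy)
  · rw [Finset.sum_image hinj]
    apply Finset.sum_lt_sum (fun A _ => hle A)
    refine ⟨A₀, hA₀, ?_⟩
    have hm : j ∈ A₀ ∧ i ∉ A₀ ∧ σ A₀ ∉ F := ⟨hj, hi, by rw [hσe A₀ hj hi]; exact hA₀'⟩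
    simp only [hSdef, if_pos hm]
    rw [hσe A₀ hj hi, Finset.sum_insert (by simp [hi])]
    have := Finset.add_sum_erase A₀ (fun x => x) hj
    omega

lemma exists_shifted (V : Finset ℕ) (K t : ℕ) (F : Finset (Finset ℕ))
    (hF : F ⊆ V.powersetCard K) (hM : ¬ HasM F t) :
    ∃ G ⊆ V.powersetCard K, G.card = F.card ∧ ¬ HasM G t ∧ Shifted V G := by
  induction hw : ∑ A ∈ F, ∑ a ∈ A, a using Nat.strong_induction_on generalizing F with
  | _ w ih =>
    by_cases hS : Shifted V F
    · exact ⟨F, hF, rfl, hM, hS⟩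
    · obtain ⟨G, hG, hc, hGM, hlt⟩ := shift_step V K t F hF hM hS
      obtain ⟨H, h1, h2, h3, h4⟩ := ih _ (hw ▸ hlt) G hG hGM rfl
      exact ⟨H, h1, h2.trans hc, h3, h4⟩

open Finset in
lemma local_lym (V : Finset ℕ) (K : ℕ) (F : Finset (Finset ℕ)) (hF : F ⊆ V.powersetCard (K + 1)) :
    F.card * (K + 1) ≤ (shadow F).card * (V.card - K) := by
  apply Finset.card_mul_le_card_mul (fun A B : Finset ℕ => B ⊆ A)
  · intro A hA
    have hAP := mem_powersetCard.1 (hF hA)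
    rw [← hAP.2, ← Finset.card_image_of_injOn (f := fun a => A.erase a) (s := A)]
    · apply Finset.card_le_card
      intro B hB
      obtain ⟨a, ha, rfl⟩ := Finset.mem_image.1 hB
      simp only [bipartiteAbove, mem_filter]
      exact ⟨erase_mem_shadow hA ha, erase_subset _ _⟩
    · exact Finset.erase_injOn A
  · intro B hB
    obtain ⟨A, hA, a, ha, rfl⟩ := mem_shadow_iff.1 hB
    have hAP := mem_powersetCard.1 (hF hA)
    have hBc : (A.erase a).card = K := by rw [card_erase_of_mem ha, hAP.2]; rfl
    have hBV : A.erase a ⊆ V := (erase_subset _ _).trans hAP.1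
    set B := A.erase a
    rw [← hBc, ← card_sdiff_of_subset hBV]
    have : bipartiteBelow (fun A B : Finset ℕ => B ⊆ A) F B ⊆ (V \ B).image (fun x => insert x B) := by
      intro C hC
      simp only [bipartiteBelow, mem_filter] at hC
      have hCP := mem_powersetCard.1 (hF hC.1)
      have : (C \ B).card = 1 := by rw [card_sdiff_of_subset hC.2, hCP.2, hBc]; omega
      obtain ⟨x, hx⟩ := card_eq_one.1 this
      have hxm : x ∈ C \ B := by rw [hx]; simp
      rw [mem_sdiff] at hxm
      refine mem_image.2 ⟨x, mem_sdiff.2 ⟨hCP.1 hxm.1, hxm.2⟩, ?_⟩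
      have := sdiff_union_of_subset hC.2
      rw [hx] at this
      rw [← this, insert_eq]
    exact (card_le_card this).trans card_image_le

open Finset in
lemma shadow_bound (s : ℕ) (V : Finset ℕ) : ∀ (K : ℕ) (F : Finset (Finset ℕ)),
    F ⊆ V.powersetCard (K + 1) → Shifted V F → ¬ HasM F (s + 1) →
    F.card ≤ s * (shadow F).card := by
  induction V using Finset.induction_on_max with
  | empty =>
    intro K F hF _ _
    have : F = ∅ := by
      rw [← subset_empty]
      intro A hA
      have h := mem_powersetCard.1 (hF hA)
      have h2 : A = ∅ := subset_empty.1 h.1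
      have h3 := h.2
      rw [h2, card_empty] at h3
      omega
    simp [this]
  | insert a V hV ih =>
    intro K F hF hS hM
    have haV : a ∉ V := fun h => lt_irrefl _ (hV a h)
    by_cases hsmall : (insert a V).card < (s + 1) * (K + 1)
    · have h := local_lym (insert a V) K F hF
      have h2 : (insert a V).card - K ≤ s * (K + 1) := by
        rw [add_mul] at hsmall; omega
      have h3 : F.card * (K + 1) ≤ (s * (shadow F).card) * (K + 1) := by
        calc _ ≤ _ := h
          _ ≤ (shadow F).card * (s * (K + 1)) := Nat.mul_le_mul_left _ h2
          _ = _ := by ring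
      exact Nat.le_of_mul_le_mul_right h3 (Nat.succ_pos _)
    push Not at hsmall
    rcases K with _ | K
    · -- singletons
      have hc : F.card ≤ s := by
        by_contra hc
        push Not at hc
        apply hM
        have : Fintype.card (Fin (s + 1)) ≤ Fintype.card F := by simpa using hc
        obtain ⟨e⟩ := Function.Embedding.nonempty_of_card_le this
        refine ⟨fun x => (e x).1, fun x => (e x).2, ?_⟩
        intro x y hxy
        have h1 := (mem_powersetCard.1 (hF (e x).2)).2
        have h2 := (mem_powersetCard.1 (hF (e y).2)).2
        obtain ⟨u, hu⟩ := card_eq_one.1 h1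
        obtain ⟨v, hv⟩ := card_eq_one.1 h2
        show Disjoint (e x).1 (e y).1
        rw [hu, hv, disjoint_singleton]
        rintro rfl
        exact hxy (e.injective (Subtype.ext (hu.trans hv.symm)))
      rcases F.eq_empty_or_nonempty with rfl | ⟨A, hA⟩
      · simp
      · have h1 := (mem_powersetCard.1 (hF hA)).2
        obtain ⟨u, hu⟩ := card_eq_one.1 h1
        have : 0 < (shadow F).card :=
          card_pos.2 ⟨A.erase u, erase_mem_shadow hA (by rw [hu]; simp)⟩
        calc F.card ≤ s * 1 := by omega
          _ ≤ _ := Nat.mul_le_mul_left _ this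
    · set F0 := F.filter (fun A => a ∉ A) with hF0
      set F1 := (F.filter (fun A => a ∈ A)).image (fun A => A.erase a) with hF1
      have memF1 : ∀ B, B ∈ F1 ↔ a ∉ B ∧ insert a B ∈ F := by
        intro B
        simp only [hF1, mem_image, mem_filter]
        constructor
        · rintro ⟨A, ⟨hA, haA⟩, rfl⟩
          refine ⟨by simp, ?_⟩
          rw [insert_erase haA]; exact hA
        · rintro ⟨h1, h2⟩
          exact ⟨insert a B, ⟨h2, by simp⟩, erase_insert h1⟩
      have hcard : F.card = F0.card + F1.card := by
        rw [hF1, card_image_of_injOn, hF0, add_comm]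
        · exact (card_filter_add_card_filter_not (s := F) (fun A => a ∈ A)).symm
        · intro A hA B hB hAB
          simp only [coe_filter, Set.mem_ofPred_eq] at hA hB
          rw [← insert_erase hA.2, ← insert_erase hB.2]
          exact congrArg _ hAB
      have hF0P : F0 ⊆ V.powersetCard (K + 1 + 1) := by
        intro A hA
        rw [hF0, mem_filter] at hA
        have := mem_powersetCard.1 (hF hA.1)
        exact mem_powersetCard.2 ⟨(subset_insert_iff_of_notMem hA.2).1 this.1, this.2⟩
      have hF1P : F1 ⊆ V.powersetCard (K + 1) := by
        intro A hA
        rw [memF1] at hA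
        have := mem_powersetCard.1 (hF hA.2)
        refine mem_powersetCard.2 ⟨?_, ?_⟩
        · exact (insert_subset_insert_iff hA.1).1 this.1
        · have h2 := this.2
          rw [card_insert_of_notMem hA.1] at h2; omega
      have hS0 : Shifted V F0 := by
        intro A hA j hj i hi hij hiA
        rw [hF0, mem_filter] at hA ⊢
        refine ⟨hS A hA.1 j hj i (mem_insert_of_mem hi) hij hiA, ?_⟩
        intro h
        rcases mem_insert.1 h with h | h
        · exact haV (h ▸ hi)
        · exact hA.2 (mem_of_mem_erase h)
      have hS1 : Shifted V F1 := by
        intro A hA j hj i hi hij hiA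
        rw [memF1] at hA ⊢
        have hia : i ≠ a := fun h => haV (h ▸ hi)
        have hja : j ≠ a := fun h => hA.1 (h ▸ hj)
        refine ⟨?_, ?_⟩
        · intro h
          rcases mem_insert.1 h with h | h
          · exact hia h.symm
          · exact hA.1 (mem_of_mem_erase h)
        · have := hS _ hA.2 j (mem_insert_of_mem hj) i (mem_insert_of_mem hi) hij
            (by simp [hia, hiA])
          rwa [erase_insert_of_ne hja.symm, insert_comm] at this
      have hM0 : ¬ HasM F0 (s + 1) := by
        rintro ⟨f, hf, hd⟩
        exact hM ⟨f, fun x => (mem_filter.1 (hf x)).1, hd⟩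
      have hM1 : ¬ HasM F1 (s + 1) := by
        rintro ⟨f, hf, hd⟩
        apply hM
        set U := univ.biUnion f with hU
        have hUc : U.card ≤ (s + 1) * (K + 1) := by
          calc U.card ≤ (univ : Finset (Fin (s + 1))).card * (K + 1) :=
                card_biUnion_le_card_mul _ _ _
                  (fun x _ => (mem_powersetCard.1 (hF1P (hf x))).2.le)
            _ = _ := by simp
        have hW : s + 1 ≤ ((insert a V) \ U).card := by
          have := le_card_sdiff U (insert a V)
          have e : (s + 1) * (K + 1 + 1) = (s + 1) * (K + 1) + (s + 1) := by ring
          omega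
        have : Fintype.card (Fin (s + 1)) ≤ Fintype.card ↥((insert a V) \ U) := by simpa using hW
        obtain ⟨e⟩ := Function.Embedding.nonempty_of_card_le this
        have heU : ∀ x y, (e x).1 ∉ f y := by
          intro x y h
          have := (mem_sdiff.1 (e x).2).2
          exact this (mem_biUnion.2 ⟨y, mem_univ _, h⟩)
        refine ⟨fun x => insert (e x).1 (f x), ?_, ?_⟩
        · intro x
          have hx := (memF1 _).1 (hf x)
          show insert (e x).1 (f x) ∈ F
          by_cases hea : (e x).1 = a
          · rw [hea]; exact hx.2
          · have hmem := (mem_sdiff.1 (e x).2).1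
            have hV' : (e x).1 ∈ V := by
              rcases mem_insert.1 hmem with h | h
              · exact absurd h hea
              · exact h
            have := hS _ hx.2 a (by simp) (e x).1 hmem (hV _ hV') (by simp [hea, heU x x])
            rwa [erase_insert hx.1] at this
        · intro x y hxy
          show Disjoint (insert (e x).1 (f x)) (insert (e y).1 (f y))
          rw [disjoint_insert_left, disjoint_insert_right]
          refine ⟨?_, heU y x, hd hxy⟩
          intro h
          rcases mem_insert.1 h with h | h
          · exact hxy (e.injective (Subtype.ext h))
          · exact heU x y h
      have i0 := ih (K + 1) F0 hF0P hS0 hM0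
      have i1 := ih K F1 hF1P hS1 hM1
      have hsh : (shadow F0).card + (shadow F1).card ≤ (shadow F).card := by
        have hnot1 : ∀ B ∈ shadow F1, a ∉ B := by
          intro B hB h
          obtain ⟨A, hA, x, hx, rfl⟩ := mem_shadow_iff.1 hB
          exact ((memF1 _).1 hA).1 (mem_of_mem_erase h)
        have hc1 : ((shadow F1).image (insert a)).card = (shadow F1).card := by
          apply card_image_of_injOn
          intro A hA B hB hAB
          have h1 := hnot1 A hA
          have h2 := hnot1 B hB
          rw [← erase_insert h1, ← erase_insert h2]
          exact congrArg (fun X => X.erase a) hAB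
        rw [← hc1, ← card_union_of_disjoint]
        · apply card_le_card
          intro B hB
          rcases mem_union.1 hB with hB | hB
          · exact shadow_mono (filter_subset _ _) hB
          · obtain ⟨C, hC, rfl⟩ := mem_image.1 hB
            obtain ⟨A, hA, x, hx, rfl⟩ := mem_shadow_iff.1 hC
            have hA' := (memF1 _).1 hA
            have hxa : x ≠ a := fun h => hA'.1 (h ▸ hx)
            rw [← erase_insert_of_ne hxa.symm]
            exact erase_mem_shadow hA'.2 (mem_insert_of_mem hx)
        · rw [disjoint_left]
          intro B hB hB'
          obtain ⟨C, hC, rfl⟩ := mem_image.1 hB'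
          obtain ⟨A, hA, x, hx, h⟩ := mem_shadow_iff.1 hB
          have : a ∈ A := mem_of_mem_erase (h ▸ mem_insert_self a C)
          exact (mem_filter.1 hA).2 this
      calc F.card = F0.card + F1.card := hcard
        _ ≤ s * (shadow F0).card + s * (shadow F1).card := add_le_add i0 i1
        _ = s * ((shadow F0).card + (shadow F1).card) := by ring
        _ ≤ _ := Nat.mul_le_mul_left _ hsh

lemma no_sdr_bound (s m : ℕ) (N : ℕ → Finset (Fin m))
    (hN : ∀ i j, i ≤ j → j ≤ s → N j ⊆ N i)
    (hno : ¬ ∃ f : Fin (s + 1) → Fin m, Function.Injective f ∧ ∀ x : Fin (s + 1), f x ∈ N x) :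
    ∑ i ∈ Finset.range s, (N i).card + (s + 1) * (N s).card ≤ s * max m (2 * s + 1) := by
  have ht : ∃ t ≤ s, (N (s - t)).card ≤ t := by
    by_contra hcon
    push Not at hcon
    apply hno
    apply (Finset.all_card_le_biUnion_card_iff_exists_injective
      (fun x : Fin (s + 1) => N x)).1
    intro S
    rcases S.eq_empty_or_nonempty with rfl | hS
    · simp
    · set i := S.min' hS with hi
      have h1 : S ⊆ Finset.Ici i := fun x hx => Finset.mem_Ici.2 (Finset.min'_le S x hx)
      have h2 : S.card ≤ s + 1 - i := by
        have := Finset.card_le_card h1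
        rwa [Fin.card_Ici] at this
      have h3 : N i ⊆ S.biUnion (fun x : Fin (s + 1) => N x) :=
        Finset.subset_biUnion_of_mem (fun x : Fin (s + 1) => N x) (Finset.min'_mem S hS)
      have h4 := Finset.card_le_card h3
      have h5 := hcon (s - i) (Nat.sub_le _ _)
      have hi' : (i : ℕ) ≤ s := Nat.lt_succ_iff.1 i.2
      have h6 : s - (s - (i : ℕ)) = i := by omega
      rw [h6] at h5
      omega
  obtain ⟨t, hts, ht⟩ := ht
  have hs : (N s).card ≤ t := (Finset.card_le_card (hN _ _ (Nat.sub_le s t) le_rfl)).trans ht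
  have hm : ∀ i, (N i).card ≤ m := fun i => by simpa using Finset.card_le_univ (N i)
  have hsum : ∑ i ∈ Finset.range s, (N i).card ≤ (s - t) * m + t * t := by
    have e : s = (s - t) + t := by omega
    conv_lhs => rw [e]
    rw [Finset.sum_range_add]
    apply add_le_add
    · calc _ ≤ (Finset.range (s - t)).card * m := Finset.sum_le_card_nsmul _ _ _ (fun i _ => hm i)
        _ = _ := by simp
    · calc _ ≤ (Finset.range t).card * t := Finset.sum_le_card_nsmul _ _ _ (fun i hi => by
            refine (Finset.card_le_card (hN (s - t) _ (by omega) ?_)).trans ht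
            have := Finset.mem_range.1 hi
            omega)
        _ = _ := by simp
  obtain ⟨w, rfl⟩ : ∃ w, s = w + t := ⟨s - t, by omega⟩
  have e2 : w + t - t = w := by omega
  rw [e2] at hsum
  set X := max m (2 * (w + t) + 1) with hX
  have hX1 : m ≤ X := le_max_left _ _
  have hX2 : 2 * (w + t) + 1 ≤ X := le_max_right _ _
  calc _ ≤ w * m + t * t + (w + t + 1) * t := by gcongr
    _ ≤ w * X + t * (2 * (w + t) + 1) := by nlinarith
    _ ≤ w * X + t * X := by gcongr
    _ = _ := by ring

open Classical in
lemma perm_count (Y : Finset ℕ) (r : ℕ) (φ : Fin r ↪ Y) (A : Finset ℕ)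
    (hA : A ∈ Y.powersetCard r) :
    (Finset.univ.filter (fun σ : Equiv.Perm Y =>
      Finset.univ.image (fun j => ((σ (φ j) : Y) : ℕ)) = A)).card * Y.card.choose r
      = Fintype.card (Equiv.Perm Y) := by
  set blk : Equiv.Perm Y → Finset ℕ := fun σ => Finset.univ.image (fun j => ((σ (φ j) : Y) : ℕ))
    with hblk
  have hmem : ∀ σ, blk σ ∈ Y.powersetCard r := by
    intro σ
    rw [Finset.mem_powersetCard]
    constructor
    · intro x hx
      obtain ⟨j, -, rfl⟩ := Finset.mem_image.1 hx
      exact (σ (φ j)).2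
    · rw [hblk, Finset.card_image_of_injective]
      · simp
      · intro a b hab
        exact φ.injective (σ.injective (Subtype.ext hab))
  have hle : ∀ A ∈ Y.powersetCard r, ∀ B ∈ Y.powersetCard r,
      (Finset.univ.filter (fun σ => blk σ = A)).card
        ≤ (Finset.univ.filter (fun σ => blk σ = B)).card := by
    intro A hA B hB
    rw [Finset.mem_powersetCard] at hA hB
    have hc : Fintype.card {x : Y // (x : ℕ) ∈ A} = Fintype.card {x : Y // (x : ℕ) ∈ B} := by
      have key : ∀ C : Finset ℕ, C ⊆ Y → Fintype.card {x : Y // (x : ℕ) ∈ C} = C.card := by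
        intro C hC
        rw [← Fintype.card_coe C]
        apply Fintype.card_congr
        exact ⟨fun x => ⟨x.1.1, x.2⟩, fun x => ⟨⟨x.1, hC x.2⟩, x.2⟩, fun x => rfl, fun x => rfl⟩
      rw [key A hA.1, key B hB.1, hA.2, hB.2]
    obtain ⟨e⟩ := Fintype.card_eq.1 hc
    set τ : Equiv.Perm Y := e.extendSubtype with hτ
    apply Finset.card_le_card_of_injOn (fun σ => τ * σ)
    · intro σ hσ
      simp only [Finset.coe_filter, Finset.mem_univ, true_and, Set.mem_ofPred_eq] at hσ ⊢
      apply Finset.eq_of_subset_of_card_le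
      · intro x hx
        obtain ⟨j, -, rfl⟩ := Finset.mem_image.1 hx
        have : ((σ (φ j) : Y) : ℕ) ∈ A := by
          rw [← hσ]; exact Finset.mem_image_of_mem _ (Finset.mem_univ j)
        exact e.extendSubtype_mem _ this
      · rw [hB.2, (Finset.mem_powersetCard.1 (hmem _)).2]
    · intro σ _ σ' _ h
      exact mul_left_cancel h
  have hsum : ∑ B ∈ Y.powersetCard r, (Finset.univ.filter (fun σ => blk σ = B)).card
      = Fintype.card (Equiv.Perm Y) := by
    rw [← Finset.card_eq_sum_card_fiberwise (fun σ _ => hmem σ), Finset.card_univ]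
  rw [← hsum, Finset.sum_congr rfl (fun B hB => le_antisymm (hle B hB A hA) (hle A hA B hB))]
  rw [Finset.sum_const, Finset.card_powersetCard, smul_eq_mul, mul_comm]

open Classical in
lemma cross_bound (Y : Finset ℕ) (r s m : ℕ) (G : ℕ → Finset (Finset ℕ))
    (hG : ∀ i, i ≤ s → G i ⊆ Y.powersetCard r)
    (hN : ∀ i j, i ≤ j → j ≤ s → G j ⊆ G i)
    (hno : ¬ ∃ f : Fin (s + 1) → Finset ℕ, (∀ i : Fin (s + 1), f i ∈ G i) ∧
      Pairwise (fun i j => Disjoint (f i) (f j)))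
    (hm : m * r ≤ Y.card) :
    m * (∑ i ∈ Finset.range s, (G i).card + (s + 1) * (G s).card)
      ≤ s * max m (2 * s + 1) * Y.card.choose r := by
  have hcard : Fintype.card (Fin m × Fin r) ≤ Fintype.card Y := by simpa using hm
  obtain ⟨φ⟩ := Function.Embedding.nonempty_of_card_le hcard
  set ψ : Fin m → (Fin r ↪ Y) := fun b =>
    ⟨fun j => φ (b, j), fun x y h => by simpa using φ.injective h⟩ with hψ
  set blk : Fin m → Equiv.Perm Y → Finset ℕ :=
    fun b σ => Finset.univ.image (fun j => ((σ (ψ b j) : Y) : ℕ)) with hblk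
  set D : Equiv.Perm Y → ℕ → Finset (Fin m) :=
    fun σ i => Finset.univ.filter (fun b => blk b σ ∈ G i) with hD
  have hdisj : ∀ σ b c, b ≠ c → Disjoint (blk b σ) (blk c σ) := by
    intro σ b c hbc
    rw [Finset.disjoint_left]
    intro x hx hy
    obtain ⟨j, -, rfl⟩ := Finset.mem_image.1 hx
    obtain ⟨j', -, h⟩ := Finset.mem_image.1 hy
    have := φ.injective (σ.injective (Subtype.ext h))
    exact hbc (congrArg Prod.fst this).symm
  have hpt : ∀ σ, ∑ i ∈ Finset.range s, (D σ i).card + (s + 1) * (D σ s).card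
      ≤ s * max m (2 * s + 1) := by
    intro σ
    apply no_sdr_bound
    · intro i j hij hj b hb
      simp only [hD, Finset.mem_filter, Finset.mem_univ, true_and] at hb ⊢
      exact hN i j hij hj hb
    · rintro ⟨f, hf, hfm⟩
      apply hno
      refine ⟨fun x => blk (f x) σ, ?_, ?_⟩
      · intro x
        have := hfm x
        simpa only [hD, Finset.mem_filter, Finset.mem_univ, true_and] using this
      · intro x y hxy
        exact hdisj σ _ _ (fun h => hxy (hf h))
  set P := Fintype.card (Equiv.Perm Y) with hP
  have hcount : ∀ i ≤ s, (∑ σ, (D σ i).card) * Y.card.choose r = m * (G i).card * P := by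
    intro i hi
    have h1 : ∑ σ, (D σ i).card
        = ∑ b : Fin m, ∑ A ∈ G i, (Finset.univ.filter (fun σ => blk b σ = A)).card := by
      have : ∀ σ, (D σ i).card = ∑ b : Fin m, if blk b σ ∈ G i then 1 else 0 := by
        intro σ
        rw [hD, Finset.card_filter]
      simp_rw [this]
      rw [Finset.sum_comm]
      apply Finset.sum_congr rfl
      intro b _
      rw [← Finset.card_filter, Finset.card_eq_sum_card_fiberwise (f := blk b) (t := G i)]
      · apply Finset.sum_congr rfl
        intro A hA
        congr 1
        ext σ
        simp only [Finset.mem_filter, Finset.mem_univ, true_and]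
        constructor
        · exact fun h => h.2
        · exact fun h => ⟨h ▸ hA, h⟩
      · intro σ hσ
        simpa using hσ
    rw [h1, Finset.sum_mul]
    have h2 : ∀ b : Fin m, (∑ A ∈ G i, (Finset.univ.filter (fun σ => blk b σ = A)).card)
        * Y.card.choose r = (G i).card * P := by
      intro b
      rw [Finset.sum_mul, Finset.sum_congr rfl
        (fun A hA => perm_count Y r (ψ b) A (hG i hi hA)), Finset.sum_const, smul_eq_mul]
    rw [Finset.sum_congr rfl (fun b _ => h2 b)]
    simp [mul_assoc]
  have hPpos : 0 < P := Fintype.card_pos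
  apply Nat.le_of_mul_le_mul_right _ hPpos
  calc m * (∑ i ∈ Finset.range s, (G i).card + (s + 1) * (G s).card) * P
      = ∑ i ∈ Finset.range s, m * (G i).card * P + (s + 1) * (m * (G s).card * P) := by
        rw [← Finset.sum_mul, ← Finset.mul_sum]; ring
    _ = ∑ i ∈ Finset.range s, (∑ σ, (D σ i).card) * Y.card.choose r
        + (s + 1) * ((∑ σ, (D σ s).card) * Y.card.choose r) := by
        rw [hcount s le_rfl]
        congr 1
        apply Finset.sum_congr rfl
        intro i hi
        rw [hcount i (Finset.mem_range.1 hi).le]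
    _ = (∑ σ, (∑ i ∈ Finset.range s, (D σ i).card + (s + 1) * (D σ s).card))
          * Y.card.choose r := by
        rw [← Finset.sum_mul, Finset.sum_add_distrib, Finset.sum_comm, ← Finset.mul_sum]; ring
    _ ≤ (∑ _σ : Equiv.Perm Y, s * max m (2 * s + 1)) * Y.card.choose r := by
        gcongr with σ _
        exact hpt σ
    _ = _ := by
        rw [Finset.sum_const, Finset.card_univ, smul_eq_mul]; ring

open Finset in
lemma one_count (s K : ℕ) (V : Finset ℕ) (F : Finset (Finset ℕ)) (hF : F ⊆ V.powersetCard (K + 1)) :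
    (F.filter (fun A => (A ∩ range (s + 1)).card = 1)).card
      = ∑ i ∈ range (s + 1), ((powersetCard K (V \ range (s + 1))).filter
          (fun B => insert i B ∈ F)).card := by
  set T := range (s + 1) with hT
  have key : F.filter (fun A => (A ∩ T).card = 1) = T.biUnion (fun i =>
      ((powersetCard K (V \ T)).filter (fun B => insert i B ∈ F)).image (insert i)) := by
    ext A
    simp only [mem_filter, mem_biUnion, mem_image]
    constructor
    · rintro ⟨hA, hc⟩
      obtain ⟨i, hi⟩ := card_eq_one.1 hc
      have him : i ∈ A ∩ T := by rw [hi]; simp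
      rw [mem_inter] at him
      have hAP := mem_powersetCard.1 (hF hA)
      refine ⟨i, him.2, A.erase i, ⟨?_, ?_⟩, insert_erase him.1⟩
      · rw [mem_powersetCard]
        refine ⟨?_, by rw [card_erase_of_mem him.1, hAP.2]; rfl⟩
        intro x hx
        rw [mem_erase] at hx
        refine mem_sdiff.2 ⟨hAP.1 hx.2, fun hxT => hx.1 ?_⟩
        have : x ∈ A ∩ T := mem_inter.2 ⟨hx.2, hxT⟩
        rw [hi] at this
        exact mem_singleton.1 this
      · rw [insert_erase him.1]; exact hA
    · rintro ⟨i, hi, B, ⟨hB, hBF⟩, rfl⟩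
      refine ⟨hBF, card_eq_one.2 ⟨i, ?_⟩⟩
      have hBP := mem_powersetCard.1 hB
      ext x
      simp only [mem_inter, mem_insert, mem_singleton]
      constructor
      · rintro ⟨rfl | hx, hxT⟩
        · rfl
        · exact absurd hxT (mem_sdiff.1 (hBP.1 hx)).2
      · rintro rfl
        exact ⟨Or.inl rfl, hi⟩
  have hnot : ∀ i ∈ T, ∀ j ∈ T, ∀ B ∈ (powersetCard K (V \ T)).filter (fun B => insert j B ∈ F),
      i ∉ B := by
    intro i hi j _ B hB h
    have hBP := mem_powersetCard.1 (mem_filter.1 hB).1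
    exact (mem_sdiff.1 (hBP.1 h)).2 hi
  rw [key, card_biUnion]
  · apply sum_congr rfl
    intro i hi
    apply card_image_of_injOn
    intro A hA B hB hAB
    rw [← erase_insert (hnot i hi i hi A hA), ← erase_insert (hnot i hi i hi B hB)]
    exact congrArg (fun X => X.erase i) hAB
  · intro i hi j hj hij
    show Disjoint (image _ _) (image _ _)
    rw [disjoint_left]
    intro A hA hA'
    obtain ⟨B, hB, rfl⟩ := mem_image.1 hA
    obtain ⟨C, hC, h⟩ := mem_image.1 hA'
    have : i ∈ insert j C := by rw [h]; simp
    rcases mem_insert.1 this with h | h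
    · exact hij h
    · exact hnot i hi j hj C hC h

open Finset in
lemma comb_bound (N K s m : ℕ) (hN : s + 1 ≤ N) (F : Finset (Finset ℕ))
    (hF : F ⊆ (range N).powersetCard (K + 1)) (hM : ¬ HasM F (s + 1))
    (hm : m * K ≤ N - (s + 1)) :
    m * (F.card + (N - (s + 1)).choose (K + 1) + (s + 1) * (N - (s + 1)).choose K)
      ≤ m * N.choose (K + 1) + s * max m (2 * s + 1) * (N - (s + 1)).choose K := by
  obtain ⟨F₂, hF₂, hc, hM₂, hS⟩ := exists_shifted _ _ _ F hF hM
  rw [← hc]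
  clear hc hM hF F
  revert F₂
  intro F hF hM hS
  set P := (range N).powersetCard (K + 1) with hP
  set T := range (s + 1) with hT
  set Y := range N \ T with hY
  have hTN : T ⊆ range N := range_subset_range.2 hN
  have hYc : Y.card = N - (s + 1) := by
    rw [hY, card_sdiff_of_subset hTN, card_range, hT, card_range]
  set G : ℕ → Finset (Finset ℕ) := fun i => (powersetCard K Y).filter (fun B => insert i B ∈ F)
    with hG
  set F0 := F.filter (fun A => (A ∩ T).card = 0) with hF0
  have split : ∀ E : Finset (Finset ℕ), E.card = (E.filter (fun A => (A ∩ T).card = 0)).card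
      + (E.filter (fun A => (A ∩ T).card = 1)).card
      + (E.filter (fun A => 2 ≤ (A ∩ T).card)).card := by
    intro E
    simp only [card_filter]
    rw [← sum_add_distrib, ← sum_add_distrib, card_eq_sum_ones]
    apply sum_congr rfl
    intro A _
    split_ifs <;> omega
  have hP0 : P.filter (fun A => (A ∩ T).card = 0) = powersetCard (K + 1) Y := by
    ext A
    rw [mem_filter, hP, mem_powersetCard, mem_powersetCard, card_eq_zero,
      ← disjoint_iff_inter_eq_empty, hY, subset_sdiff]
    tauto
  have hF0P : F0 ⊆ powersetCard (K + 1) Y := by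
    rw [← hP0]; exact filter_subset_filter _ hF
  have hP1 : (P.filter (fun A => (A ∩ T).card = 1)).card
      = (s + 1) * (N - (s + 1)).choose K := by
    rw [one_count s K (range N) P le_rfl]
    rw [sum_congr rfl (g := fun _ => (N - (s + 1)).choose K)]
    · simp
    · intro i hi
      rw [filter_true_of_mem, card_powersetCard, hYc]
      intro B hB
      rw [mem_powersetCard] at hB
      have hiB : i ∉ B := fun h => (mem_sdiff.1 (hB.1 h)).2 hi
      rw [hP, mem_powersetCard]
      refine ⟨insert_subset (hTN hi) (hB.1.trans sdiff_subset), ?_⟩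
      rw [card_insert_of_notMem hiB, hB.2]
  have hF1 := one_count s K (range N) F hF
  have hF2 : (F.filter (fun A => 2 ≤ (A ∩ T).card)).card
      ≤ (P.filter (fun A => 2 ≤ (A ∩ T).card)).card := card_le_card (filter_subset_filter _ hF)
  have sF := split F
  have sP := split P
  have hPc : P.card = N.choose (K + 1) := by rw [hP, card_powersetCard, card_range]
  rw [hP0, hP1, card_powersetCard (K + 1) Y, hYc, hPc] at sP
  -- shadow
  have hS0 : Shifted Y F0 := by
    intro A hA j hj i hi hij hiA
    have hAY := (mem_powersetCard.1 (hF0P hA)).1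
    rw [hF0, mem_filter] at hA ⊢
    refine ⟨hS A hA.1 j hj i (sdiff_subset hi) hij hiA, ?_⟩
    rw [card_eq_zero, ← disjoint_iff_inter_eq_empty]
    apply disjoint_of_subset_left _ (sdiff_disjoint : Disjoint (range N \ T) T)
    exact insert_subset hi ((erase_subset _ _).trans hAY)
  have hM0 : ¬ HasM F0 (s + 1) := by
    rintro ⟨f, hf, hd⟩
    exact hM ⟨f, fun x => (mem_filter.1 (hf x)).1, hd⟩
  have hsh := shadow_bound s Y K F0 hF0P hS0 hM0
  have hshG : shadow F0 ⊆ G s := by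
    intro B hB
    obtain ⟨A, hA, a, ha, rfl⟩ := mem_shadow_iff.1 hB
    have hAY := mem_powersetCard.1 (hF0P hA)
    rw [hG, mem_filter, mem_powersetCard]
    refine ⟨⟨(erase_subset _ _).trans hAY.1, by rw [card_erase_of_mem ha, hAY.2]; rfl⟩, ?_⟩
    have haY := mem_sdiff.1 (hAY.1 ha)
    have hsT : s ∈ T := by simp [hT]
    apply hS A (mem_filter.1 hA).1 a ha s (hTN hsT)
    · have := haY.2
      rw [hT, mem_range] at this
      omega
    · intro h
      exact (mem_sdiff.1 (hAY.1 h)).2 hsT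
  have hsh2 : F0.card ≤ s * (G s).card := hsh.trans (Nat.mul_le_mul_left _ (card_le_card hshG))
  have hcross := cross_bound Y K s m G (fun i _ => filter_subset _ _) (by
      intro i j hij hj B hB
      rw [hG, mem_filter] at hB ⊢
      refine ⟨hB.1, ?_⟩
      have hBY := mem_powersetCard.1 hB.1
      have hTm : ∀ x, x ≤ s → x ∈ T := fun x hx => by rw [hT, mem_range]; omega
      have hBT : ∀ x, x ≤ s → x ∉ B := fun x hx h => (mem_sdiff.1 (hBY.1 h)).2 (hTm x hx)
      rcases hij.eq_or_lt with rfl | hlt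
      · exact hB.2
      · have := hS _ hB.2 j (mem_insert_self _ _) i (hTN (hTm i (by omega))) hlt (by
          rw [mem_insert, not_or]
          exact ⟨by omega, hBT i (by omega)⟩)
        rwa [erase_insert (hBT j hj)] at this) (by
      rintro ⟨f, hf, hd⟩
      apply hM
      have hf' : ∀ x : Fin (s + 1), f x ⊆ Y ∧ insert (x : ℕ) (f x) ∈ F := by
        intro x
        have := hf x
        rw [hG, mem_filter] at this
        exact ⟨(mem_powersetCard.1 this.1).1, this.2⟩
      have hfT : ∀ x y : Fin (s + 1), (x : ℕ) ∉ f y := by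
        intro x y h
        exact (mem_sdiff.1 ((hf' y).1 h)).2 (by rw [hT, mem_range]; exact x.2)
      refine ⟨fun x => insert (x : ℕ) (f x), fun x => (hf' x).2, ?_⟩
      intro x y hxy
      show Disjoint (insert (x : ℕ) (f x)) (insert (y : ℕ) (f y))
      rw [disjoint_insert_left, disjoint_insert_right, mem_insert, not_or]
      exact ⟨⟨fun h => hxy (Fin.ext h), hfT x y⟩, hfT y x, hd hxy⟩) (by rw [hYc]; exact hm)
  rw [hYc] at hcross
  rw [sum_range_succ] at hF1
  have hfin : F.card + (N - (s + 1)).choose (K + 1) + (s + 1) * (N - (s + 1)).choose K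
      ≤ N.choose (K + 1) + (∑ i ∈ range s, (G i).card + (s + 1) * (G s).card) := by
    rw [add_mul s 1 (G s).card, one_mul]
    have e1 : (F.filter (fun A => (A ∩ T).card = 1)).card
      = ∑ i ∈ range s, (G i).card + (G s).card := hF1
    have e2 : (F.filter (fun A => (A ∩ T).card = 0)).card = F0.card := rfl
    omega
  calc _ ≤ m * (N.choose (K + 1) + (∑ i ∈ range s, (G i).card + (s + 1) * (G s).card)) :=
        Nat.mul_le_mul_left _ hfin
    _ = m * N.choose (K + 1) + m * (∑ i ∈ range s, (G i).card + (s + 1) * (G s).card) := by ring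
    _ ≤ _ := by gcongr

open Filter Topology in
lemma div_lim (a : ℕ → ℕ) (c : ℝ) (q : ℕ) (hq : 0 < q)
    (ha : Tendsto (fun n => (a n : ℝ) / n) atTop (𝓝 c)) :
    Tendsto (fun n => ((a n / q : ℕ) : ℝ) / n) atTop (𝓝 (c / q)) := by
  have hq' : (0 : ℝ) < q := by exact_mod_cast hq
  have h0 : Tendsto (fun n : ℕ => (1 : ℝ) / n) atTop (𝓝 0) := tendsto_one_div_atTop_nhds_zero_nat
  have h1 : Tendsto (fun n : ℕ => (a n : ℝ) / n / q - 1 / n) atTop (𝓝 (c / q)) := by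
    simpa using (ha.div_const (q : ℝ)).sub h0
  refine tendsto_of_tendsto_of_tendsto_of_le_of_le h1 (ha.div_const (q : ℝ)) ?_ ?_
  · intro n
    show (a n : ℝ) / n / q - 1 / n ≤ ((a n / q : ℕ) : ℝ) / n
    have h2 : (a n : ℝ) ≤ q * ((a n / q : ℕ) : ℝ) + q := by
      have h3 := Nat.div_add_mod (a n) q
      have h4 := Nat.mod_lt (a n) hq
      have : a n ≤ q * (a n / q) + q := by omega
      exact_mod_cast this
    have h5 : (a n : ℝ) / q - 1 ≤ ((a n / q : ℕ) : ℝ) := by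
      rw [sub_le_iff_le_add, div_le_iff₀ hq']; linarith
    have h6 : (a n : ℝ) / n / q - 1 / n = ((a n : ℝ) / q - 1) / n := by ring
    rw [h6]
    exact div_le_div_of_nonneg_right h5 (Nat.cast_nonneg n)
  · intro n
    show ((a n / q : ℕ) : ℝ) / n ≤ (a n : ℝ) / n / q
    have h6 : (a n : ℝ) / n / q = ((a n : ℝ) / q) / n := by ring
    rw [h6]
    exact div_le_div_of_nonneg_right Nat.cast_div_le (Nat.cast_nonneg n)

open Filter Topology in
lemma choose_lim (a : ℕ → ℕ) (c : ℝ) (hc : 0 < c) (r : ℕ)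
    (ha : Tendsto (fun n => (a n : ℝ) / n) atTop (𝓝 c)) :
    Tendsto (fun n => ((a n).choose r : ℝ) / (n : ℝ) ^ r) atTop (𝓝 (c ^ r / r.factorial)) := by
  have hinf : Tendsto a atTop atTop := by
    have h1 : Tendsto (fun n : ℕ => ((a n : ℝ) / n) * n) atTop atTop :=
      ha.pos_mul_atTop hc tendsto_natCast_atTop_atTop
    have h2 : Tendsto (fun n : ℕ => (a n : ℝ)) atTop atTop := by
      refine h1.congr' ?_
      filter_upwards [eventually_gt_atTop 0] with n hn
      have : (n : ℝ) ≠ 0 := by positivity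
      field_simp
    exact tendsto_natCast_atTop_iff.1 h2
  have hz : ∀ᶠ x : ℕ in atTop, ((x : ℝ) ^ r / r.factorial) ≠ 0 := by
    filter_upwards [eventually_gt_atTop 0] with n hn
    positivity
  have h3 := (Asymptotics.isEquivalent_iff_tendsto_one hz).1 (isEquivalent_choose r)
  have h4 := (h3.comp hinf).mul ((ha.pow r).div_const (r.factorial : ℝ))
  rw [one_mul] at h4
  refine h4.congr' ?_
  filter_upwards [eventually_gt_atTop 0, hinf.eventually_gt_atTop 0] with n hn han
  have h5 : (n : ℝ) ≠ 0 := by positivity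
  have h6 : (a n : ℝ) ≠ 0 := by positivity
  simp only [Function.comp, Pi.div_apply, div_pow]
  field_simp

open Filter Topology in
lemma asym (k d : ℕ) (hk : 3 ≤ k) (hdk : 2 * d < k) (ε : ℝ) (hε : 0 < ε) :
    ∀ᶠ n : ℕ in atTop, ∀ N S l m K : ℕ, N = n - d → S = ((n - d) - (k - d) + 1) / k → l = N - S →
      K = k - d - 1 → m = l / K →
      0 < m ∧ 0 < S ∧ S ≤ N ∧
      (N.choose (K + 1) : ℝ) - l.choose (K + 1) - S * l.choose K
        + ((S : ℝ) - 1) * (max (m : ℝ) (2 * S - 1) / m) * l.choose K ≤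
      ((1 : ℝ) - (1 - ((k : ℝ) - d) * ((k : ℝ) - 2 * d - 1) / ((k : ℝ) - 1) ^ 2) *
            (1 - 1 / (k : ℝ)) ^ (k - d) + ε) * (N.choose (K + 1) : ℝ) := by
  obtain ⟨K, hK⟩ : ∃ K, K = k - d - 1 := ⟨_, rfl⟩
  have hK1 : 1 ≤ K := by omega
  have hKr : (K : ℝ) = k - d - 1 := by
    have : k = K + d + 1 := by omega
    rw [this]; push_cast; ring
  have hkd : k - d = K + 1 := by omega
  have hKpos : (0 : ℝ) < K := by exact_mod_cast hK1
  have hk3 : (3 : ℝ) ≤ k := by exact_mod_cast hk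
  have hdk' : 2 * (d : ℝ) + 1 ≤ k := by exact_mod_cast hdk
  set N : ℕ → ℕ := fun n => n - d with hN
  set S : ℕ → ℕ := fun n => ((n - d) - (k - d) + 1) / k with hS
  set l : ℕ → ℕ := fun n => N n - S n with hl
  set m : ℕ → ℕ := fun n => l n / K with hm
  have hinv : Tendsto (fun n : ℕ => (1 : ℝ) / n) atTop (𝓝 0) := tendsto_one_div_atTop_nhds_zero_nat
  have hshift : ∀ c : ℕ, Tendsto (fun n : ℕ => ((n - c : ℕ) : ℝ) / n) atTop (𝓝 1) := by
    intro c
    have h1 : Tendsto (fun n : ℕ => (1 : ℝ) - c * (1 / n)) atTop (𝓝 1) := by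
      simpa using (tendsto_const_nhds (x := (1 : ℝ))).sub (hinv.const_mul (c : ℝ))
    refine h1.congr' ?_
    filter_upwards [eventually_gt_atTop 0, eventually_ge_atTop c] with n hn hc
    have : (n : ℝ) ≠ 0 := by positivity
    rw [Nat.cast_sub hc]
    field_simp
  have hNl : Tendsto (fun n => (N n : ℝ) / n) atTop (𝓝 1) := hshift d
  have hSl : Tendsto (fun n => (S n : ℝ) / n) atTop (𝓝 (1 / k)) := by
    apply div_lim (fun n => (n - d) - (k - d) + 1) 1 k (by omega)
    refine (hshift (k - 1)).congr' ?_
    filter_upwards [eventually_ge_atTop k] with n hn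
    have : (n - d) - (k - d) + 1 = n - (k - 1) := by omega
    rw [this]
  have hSN : ∀ n, S n ≤ N n := by
    intro n
    simp only [hS, hN]
    rcases Nat.lt_or_ge (n - d) (k - d) with h | h
    · have : n - d - (k - d) + 1 = 1 := by omega
      rw [this, Nat.div_eq_of_lt (by omega)]
      exact Nat.zero_le _
    · exact (Nat.div_le_self _ _).trans (by omega)
  have hll : Tendsto (fun n => (l n : ℝ) / n) atTop (𝓝 (1 - 1 / k)) := by
    refine (hNl.sub hSl).congr ?_
    intro n
    rw [hl, Nat.cast_sub (hSN n)]
    ring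
  have hml : Tendsto (fun n => (m n : ℝ) / n) atTop (𝓝 ((1 - 1 / k) / K)) :=
    div_lim l _ K hK1 hll
  have hc : (0 : ℝ) < 1 - 1 / k := by
    have : (1 : ℝ) / k < 1 := by rw [div_lt_one (by linarith)]; linarith
    linarith
  have hcN := choose_lim N 1 one_pos (K + 1) hNl
  have hcl := choose_lim l _ hc (K + 1) hll
  have hcl' := choose_lim l _ hc K hll
  have hmax : Tendsto (fun n : ℕ => max ((m n : ℝ) / n) (2 * ((S n : ℝ) / n) - 1 / n)) atTop
      (𝓝 (max ((1 - 1 / k) / K) (2 * (1 / k) - 0))) :=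
    hml.max ((hSl.const_mul 2).sub hinv)
  have hR := ((hcN.sub hcl).sub (hSl.mul hcl')).add
    (((hSl.sub hinv).mul (hmax.div hml (by positivity))).mul hcl')
  set g : ℝ := (1 : ℝ) - (1 - ((k : ℝ) - d) * ((k : ℝ) - 2 * d - 1) / ((k : ℝ) - 1) ^ 2) *
            (1 - 1 / (k : ℝ)) ^ (k - d) with hg
  have hL := hcN.const_mul (g + ε)
  have hlt : (1 : ℝ) ^ (K + 1) / ((K + 1).factorial : ℝ)
      - (1 - 1 / (k : ℝ)) ^ (K + 1) / ((K + 1).factorial : ℝ)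
      - 1 / (k : ℝ) * ((1 - 1 / (k : ℝ)) ^ K / (K.factorial : ℝ))
      + (1 / (k : ℝ) - 0) * (max ((1 - 1 / (k : ℝ)) / K) (2 * (1 / (k : ℝ)) - 0)
        / ((1 - 1 / (k : ℝ)) / K)) * ((1 - 1 / (k : ℝ)) ^ K / (K.factorial : ℝ))
      < (g + ε) * ((1 : ℝ) ^ (K + 1) / ((K + 1).factorial : ℝ)) := by
    have hf : (0 : ℝ) < ((K + 1).factorial : ℝ) := by positivity
    have hmx : max ((1 - 1 / (k : ℝ)) / K) (2 * (1 / (k : ℝ)) - 0) = 2 / k := by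
      rw [max_eq_right]
      · ring
      · rw [div_le_iff₀ hKpos, hKr]
        have : 0 ≤ (1 / (k : ℝ)) := by positivity
        have e : (1 : ℝ) = (1 / (k : ℝ)) * k := by field_simp
        nlinarith
    have heq : (1 : ℝ) ^ (K + 1) / ((K + 1).factorial : ℝ)
      - (1 - 1 / (k : ℝ)) ^ (K + 1) / ((K + 1).factorial : ℝ)
      - 1 / (k : ℝ) * ((1 - 1 / (k : ℝ)) ^ K / (K.factorial : ℝ))
      + (1 / (k : ℝ) - 0) * (max ((1 - 1 / (k : ℝ)) / K) (2 * (1 / (k : ℝ)) - 0)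
        / ((1 - 1 / (k : ℝ)) / K)) * ((1 - 1 / (k : ℝ)) ^ K / (K.factorial : ℝ))
      = g * (1 / ((K + 1).factorial : ℝ)) := by
      rw [hmx, hg, hkd, Nat.factorial_succ]
      have hfK : (K.factorial : ℝ) ≠ 0 := by positivity
      have hk0 : (k : ℝ) ≠ 0 := by positivity
      have hk1 : (k : ℝ) - 1 ≠ 0 := by linarith
      have hd' : (d : ℝ) = k - 1 - K := by rw [hKr]; ring
      have hcc : 1 - 1 / (k : ℝ) = ((k : ℝ) - 1) / k := by field_simp
      rw [hd', hcc, pow_succ (((k : ℝ) - 1) / k) K, one_pow]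
      generalize (((k : ℝ) - 1) / k) ^ K = q
      push_cast
      have hK0 : (K : ℝ) + 1 ≠ 0 := by positivity
      field_simp
      ring
    rw [heq, one_pow]
    have : 0 < ε * (1 / ((K + 1).factorial : ℝ)) := by positivity
    linarith
  have hev := hR.eventually_lt hL hlt
  have hmpos : ∀ᶠ n in atTop, 0 < (m n : ℝ) / n := hml.eventually (lt_mem_nhds (by positivity))
  have hSpos : ∀ᶠ n in atTop, 0 < (S n : ℝ) / n := hSl.eventually (lt_mem_nhds (by positivity))
  filter_upwards [hev, hmpos, hSpos, eventually_gt_atTop 0] with n h1 h2 h3 h4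
  intro N' S' l' m' K' eN eS el eK em
  obtain rfl : K' = K := by rw [eK, hK]
  obtain rfl : N' = N n := eN
  obtain rfl : S' = S n := eS
  obtain rfl : l' = l n := el
  obtain rfl : m' = m n := em
  have hn : (0 : ℝ) < n := by exact_mod_cast h4
  have hm0 : (0 : ℝ) < m n := by
    by_contra h
    have : (m n : ℝ) / n ≤ 0 := div_nonpos_of_nonpos_of_nonneg (not_lt.1 h) hn.le
    linarith
  have hS0 : (0 : ℝ) < S n := by
    by_contra h
    have : (S n : ℝ) / n ≤ 0 := div_nonpos_of_nonpos_of_nonneg (not_lt.1 h) hn.le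
    linarith
  refine ⟨by exact_mod_cast hm0, by exact_mod_cast hS0, hSN n, ?_⟩
  have e1 : max ((m n : ℝ) / n) (2 * ((S n : ℝ) / n) - 1 / n)
      = max (m n : ℝ) (2 * S n - 1) / n := by
    rw [← max_div_div_right hn.le]
    congr 1; ring
  simp only [Pi.div_apply] at h1
  rw [e1] at h1
  have hnp : (0 : ℝ) < (n : ℝ) ^ (K' + 1) := by positivity
  have h5 := mul_lt_mul_of_pos_right h1 hnp
  generalize max (m n : ℝ) (2 * S n - 1) = X at h5 ⊢
  have e2 : ∀ x : ℝ, x / (n : ℝ) ^ (K' + 1) * (n : ℝ) ^ (K' + 1) = x := fun x => by field_simp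
  have e3 : X / n / ((m n : ℝ) / n) = X / m n := by field_simp
  rw [e3] at h5
  refine le_trans (le_of_eq ?_) (h5.le.trans (le_of_eq ?_))
  · rw [pow_succ]; field_simp
  · rw [mul_assoc, e2]

theorem stmt_15 (k d : ℕ) (hk : 3 ≤ k) (hd : 1 ≤ d) (hdk : 2 * d < k) (ε : ℝ) (hε : 0 < ε) :
    ∃ n₀ : ℕ, ∀ n : ℕ, n₀ ≤ n →
      ∀ F : Finset (Finset ℕ), F ⊆ (Finset.range (n - d)).powersetCard (k - d) →
        ((1 : ℝ) - (1 - ((k : ℝ) - d) * ((k : ℝ) - 2 * d - 1) / ((k : ℝ) - 1) ^ 2) *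
            (1 - 1 / (k : ℝ)) ^ (k - d) + ε) * ((n - d).choose (k - d) : ℝ) < (F.card : ℝ) →
        ∃ M ⊆ F, (M : Set (Finset ℕ)).PairwiseDisjoint id ∧
          M.card = ((n - d) - (k - d) + 1) / k := by
  obtain ⟨n₀, hn₀⟩ := Filter.eventually_atTop.1 (asym k d hk hdk ε hε)
  refine ⟨n₀, fun n hn F hF hFc => ?_⟩
  have h := hn₀ n hn _ _ _ _ _ rfl rfl rfl rfl rfl
  obtain ⟨S, hS⟩ : ∃ S, S = ((n - d) - (k - d) + 1) / k := ⟨_, rfl⟩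
  obtain ⟨K, hK⟩ : ∃ K, K = k - d - 1 := ⟨_, rfl⟩
  obtain ⟨m, hm⟩ : ∃ m, m = (n - d - S) / K := ⟨_, rfl⟩
  rw [← hS, ← hK, ← hm] at h
  rw [← hS]
  obtain ⟨hm0, hS0, hSN, hle⟩ := h
  have hkd : k - d = K + 1 := by omega
  have hK1 : 1 ≤ K := by omega
  have hM : HasM F S := by
    by_contra hM
    obtain ⟨s, rfl⟩ : ∃ s, S = s + 1 := ⟨S - 1, by omega⟩
    have hF' := hF
    rw [hkd] at hF'
    have hb := comb_bound (n - d) K s m hSN F hF' hM (by rw [hm]; exact Nat.div_mul_le_self _ _)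
    have hb' : (m : ℝ) * ((F.card : ℝ) + (n - d - (s + 1)).choose (K + 1)
        + ((s : ℝ) + 1) * (n - d - (s + 1)).choose K)
        ≤ m * (n - d).choose (K + 1)
          + s * max (m : ℝ) (2 * s + 1) * (n - d - (s + 1)).choose K := by
      exact_mod_cast hb
    have hmr : (0 : ℝ) < m := by exact_mod_cast hm0
    have e : (2 * ((s + 1 : ℕ) : ℝ) - 1) = 2 * s + 1 := by push_cast; ring
    rw [e] at hle
    rw [hkd] at hFc hle
    have hlt := hle.trans_lt hFc
    push_cast at hlt
    have h2 := mul_lt_mul_of_pos_left hlt hmr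
    generalize max (m : ℝ) (2 * s + 1) = X at h2 hb'
    have h3 : (m : ℝ) * (((s : ℝ) + 1 - 1) * (X / m) * ((n - d - (s + 1)).choose K : ℝ))
        = s * X * ((n - d - (s + 1)).choose K : ℝ) := by field_simp; ring
    nlinarith
  obtain ⟨f, hf, hdis⟩ := hM
  have hinj : Function.Injective f := by
    intro x y hxy
    by_contra hne
    have h1 : Disjoint (f x) (f y) := hdis hne
    rw [← hxy, disjoint_self] at h1
    have h2 := (Finset.mem_powersetCard.1 (hF (hf x))).2
    rw [h1] at h2
    simp at h2
    omega
  refine ⟨Finset.univ.image f, ?_, ?_, ?_⟩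
  · intro A hA
    obtain ⟨x, -, rfl⟩ := Finset.mem_image.1 hA
    exact hf x
  · intro A hA B hB hAB
    obtain ⟨x, -, rfl⟩ := Finset.mem_image.1 hA
    obtain ⟨y, -, rfl⟩ := Finset.mem_image.1 hB
    exact hdis (fun h => hAB (by rw [h]))
  · rw [Finset.card_image_of_injective _ hinj]; simp
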